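/- Let (Ω, μ) be a finite measure space, let K ⊆ Ω be measurable, let v, w : Ω → ℝ be measurable with v integrable on Ω and |v|·w² integrable on Ω, and let t > 0. Then ∫_K |v|^{1/2} dμ ≤ t^{−1}·μ(Ω)^{1/2}·(∫_Ω |v|·w² dμ)^{1/2} + μ({x ∈ K : |w(x)| < t})^{1/2}·(∫_K |v| dμ)^{1/2}. -/

import Mathlib

open MeasureTheory

theorem integrable_rpow_half {Ω : Type*} [MeasurableSpace Ω] {μ : Measure Ω}
    [IsFiniteMeasure μ] {f : Ω → ℝ} (hf : Integrable f μ) (hf0 : ∀ x, 0 ≤ f x) :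
    Integrable (fun x => f x ^ ((1 : ℝ) / 2)) μ := by
  refine ((integrable_const (1 : ℝ)).add hf).mono'
    (hf.aemeasurable.pow_const _).aestronglyMeasurable (ae_of_all _ fun x => ?_)
  rw [Real.norm_of_nonneg (Real.rpow_nonneg (hf0 x) _), ← Real.sqrt_eq_rpow]
  simp only [Pi.add_apply]
  nlinarith [Real.sq_sqrt (hf0 x), sq_nonneg (√(f x) - 1), hf0 x]

/-- Cauchy–Schwarz for the square root of a nonnegative integrable function. -/
theorem integral_rpow_half_le {Ω : Type*} [MeasurableSpace Ω] {μ : Measure Ω}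
    [IsFiniteMeasure μ] {f : Ω → ℝ} (hf : Integrable f μ) (hf0 : ∀ x, 0 ≤ f x) :
    ∫ x, f x ^ ((1 : ℝ) / 2) ∂μ ≤
      (μ Set.univ).toReal ^ ((1 : ℝ) / 2) * (∫ x, f x ∂μ) ^ ((1 : ℝ) / 2) := by
  have hsq : ∀ x, (f x ^ ((1 : ℝ) / 2)) ^ (2 : ℝ) = f x := fun x => by
    rw [← Real.rpow_mul (hf0 x)]; norm_num
  have hmem : MemLp (fun x => f x ^ ((1 : ℝ) / 2)) (ENNReal.ofReal 2) μ := by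
    rw [ENNReal.ofReal_ofNat, memLp_two_iff_integrable_sq
      (hf.aemeasurable.pow_const _).aestronglyMeasurable]
    refine hf.congr (ae_of_all _ fun x => ?_)
    simpa using (hsq x).symm
  have h := integral_mul_le_Lp_mul_Lq_of_nonneg (μ := μ) Real.HolderConjugate.two_two
    (f := fun _ => (1 : ℝ)) (ae_of_all _ fun _ => zero_le_one)
    (ae_of_all _ fun x => Real.rpow_nonneg (hf0 x) _) (memLp_const 1) hmem
  simpa only [hsq, one_mul, Real.one_rpow, integral_const, smul_eq_mul, mul_one,
    Measure.real] using h

/-- Decomposition of the `L^{1/2}` quasi-norm used in the stability estimate: on a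
finite measure space, for `v` integrable, `|v|·w²` integrable and `t > 0`,
`∫_K |v|^{1/2} ≤ t⁻¹·μ(Ω)^{1/2}·(∫_Ω |v|·w²)^{1/2}
             + μ({x ∈ K : |w(x)| < t})^{1/2}·(∫_K |v|)^{1/2}`. -/
theorem stmt7 {Ω : Type*} [MeasurableSpace Ω] (μ : Measure Ω) [IsFiniteMeasure μ]
    (K : Set Ω) (hK : MeasurableSet K)
    (v w : Ω → ℝ) (hv : Measurable v) (hw : Measurable w)
    (hvint : Integrable v μ)
    (hvw2 : Integrable (fun x => |v x| * (w x) ^ 2) μ)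
    (t : ℝ) (ht : 0 < t) :
    ∫ x in K, |v x| ^ ((1:ℝ)/2) ∂μ ≤
      t⁻¹ * (μ Set.univ).toReal ^ ((1:ℝ)/2) *
          (∫ x, |v x| * (w x) ^ 2 ∂μ) ^ ((1:ℝ)/2)
        + (μ {x ∈ K | |w x| < t}).toReal ^ ((1:ℝ)/2) *
          (∫ x in K, |v x| ∂μ) ^ ((1:ℝ)/2) := by
  have hS : MeasurableSet {x | |w x| < t} := measurableSet_lt hw.abs measurable_const
  have habs : ∀ x, 0 ≤ |v x| := fun x => abs_nonneg (v x)
  have hweight : ∫ x in K \ {x | |w x| < t}, |v x| ∂μ ≤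
      t⁻¹ ^ 2 * ∫ x, |v x| * w x ^ 2 ∂μ := by
    rw [← integral_const_mul]
    refine (setIntegral_mono_on hvint.abs.integrableOn (hvw2.const_mul _).integrableOn
      (hK.diff hS) fun x hx => ?_).trans
      (setIntegral_le_integral (hvw2.const_mul _) (ae_of_all _ fun x => by positivity))
    have hx' : t ≤ |w x| := not_lt.mp hx.2
    have h1 : 1 ≤ t⁻¹ ^ 2 * w x ^ 2 := by
      rw [← mul_pow, ← sq_abs, abs_mul, abs_of_pos (inv_pos.mpr ht)]
      refine one_le_pow₀ ?_
      rwa [inv_mul_eq_div, one_le_div ht]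
    calc |v x| ≤ |v x| * (t⁻¹ ^ 2 * w x ^ 2) := le_mul_of_one_le_right (habs x) h1
      _ = t⁻¹ ^ 2 * (|v x| * w x ^ 2) := by ring
  have hfast := integral_rpow_half_le
    (hvint.abs.integrableOn (s := K \ {x | |w x| < t})) habs
  have hslow := integral_rpow_half_le
    (hvint.abs.integrableOn (s := K ∩ {x | |w x| < t})) habs
  rw [Measure.restrict_apply_univ] at hfast hslow
  rw [← integral_inter_add_sdiff hS (integrable_rpow_half hvint.abs habs).integrableOn, add_comm]
  refine add_le_add (hfast.trans ?_) (hslow.trans ?_)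
  · have hroot : (t⁻¹ ^ 2 * ∫ x, |v x| * w x ^ 2 ∂μ) ^ ((1 : ℝ) / 2) =
        t⁻¹ * (∫ x, |v x| * w x ^ 2 ∂μ) ^ ((1 : ℝ) / 2) := by
      rw [Real.mul_rpow (by positivity) (integral_nonneg fun x => by positivity),
        ← Real.sqrt_eq_rpow, Real.sqrt_sq (by positivity)]
    rw [mul_comm t⁻¹, mul_assoc, ← hroot]
    gcongr
    · exact measure_ne_top _ _
    · exact Set.subset_univ _
  · refine mul_le_mul_of_nonneg_left (Real.rpow_le_rpow (integral_nonneg habs) ?_ (by norm_num))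
      (by positivity)
    exact setIntegral_mono_set hvint.abs.integrableOn (ae_of_all _ habs)
      Set.inter_subset_left.eventuallyLE
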